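/- The function Ψ(x,t) := [−(2t−1)x² + √(x⁴ − 4x²(t−1)t)] / (2(1+x²)) satisfies the quadratic equation (1+x²)Ψ² + (2t−1)x²Ψ + x²t(t−1) = 0 and solves the PDE ∂Ψ/∂t(x,t) = x·(∂Ψ/∂x)(x,t)/Ψ(x,t) − 1 for all x>0 and 0<t<1. Its x-derivative equals ψ(x,t) = −x(2t−1)/(1+x²)² + (x² − 2t² + 2t²x² + 2t − 2tx²)/((1+x²)²·√(x² − 4(t−1)t)). -/

import Mathlib

/-- The distribution function of the radial parts for the elliptic case `α = 1/2`
(zeroes distributed SO(3)-invariantly on the Riemann sphere). -/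
noncomputable def PsiSphere (x t : ℝ) : ℝ :=
  (-(2 * t - 1) * x ^ 2 + Real.sqrt (x ^ 4 - 4 * x ^ 2 * (t - 1) * t)) / (2 * (1 + x ^ 2))

/-- For `x ≥ 0` a factor `x` can be taken out of the square root in `PsiSphere`. -/
theorem PsiSphere_eq {x : ℝ} (hx : 0 ≤ x) (t : ℝ) :
    PsiSphere x t
      = x * (√(x ^ 2 - 4 * (t - 1) * t) - (2 * t - 1) * x) / (2 * (1 + x ^ 2)) := by
  have h : x ^ 4 - 4 * x ^ 2 * (t - 1) * t = x ^ 2 * (x ^ 2 - 4 * (t - 1) * t) := by ring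
  rw [PsiSphere, h, Real.sqrt_mul (sq_nonneg x), Real.sqrt_sq hx]
  ring

theorem hasDerivAt_PsiSphere_right {x t : ℝ} (hx : 0 ≤ x)
    (h : 0 < x ^ 2 - 4 * (t - 1) * t) :
    HasDerivAt (fun s => PsiSphere x s)
      (-x * (x + (2 * t - 1) / √(x ^ 2 - 4 * (t - 1) * t)) / (1 + x ^ 2)) t := by
  have hS := Real.sqrt_pos.2 h
  have hd : HasDerivAt (fun s : ℝ => x ^ 2 - 4 * (s - 1) * s)
      (-((4 * 1) * t + 4 * (t - 1) * 1)) t :=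
    ((((hasDerivAt_id' t).sub_const 1).const_mul 4).mul (hasDerivAt_id' t)).const_sub (x ^ 2)
  have hl : HasDerivAt (fun s : ℝ => (2 * s - 1) * x) (2 * 1 * x) t :=
    (((hasDerivAt_id' t).const_mul 2).sub_const 1).mul_const x
  have H := (((hd.sqrt h.ne').sub hl).const_mul x).div_const (2 * (1 + x ^ 2))
  simp only [PsiSphere_eq hx]
  refine H.congr_deriv ?_
  have : 1 + x ^ 2 ≠ 0 := by positivity
  field_simp
  ring

theorem hasDerivAt_PsiSphere_left {x t : ℝ} (hx : 0 < x)
    (h : 0 < x ^ 2 - 4 * (t - 1) * t) :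
    HasDerivAt (fun y => PsiSphere y t)
      (-x * (2 * t - 1) / (1 + x ^ 2) ^ 2 +
        (x ^ 2 - 2 * t ^ 2 + 2 * t ^ 2 * x ^ 2 + 2 * t - 2 * t * x ^ 2) /
          ((1 + x ^ 2) ^ 2 * √(x ^ 2 - 4 * (t - 1) * t))) x := by
  have hS := Real.sqrt_pos.2 h
  have hsq := Real.sq_sqrt h.le
  have hp : HasDerivAt (fun y : ℝ => y ^ 2) (2 * x) x := by
    simpa using hasDerivAt_pow 2 x
  have hn := (hasDerivAt_id' x).mul
    (((hp.sub_const (4 * (t - 1) * t)).sqrt h.ne').sub ((hasDerivAt_id' x).const_mul (2 * t - 1)))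
  have hden : (2 * (1 + x ^ 2) : ℝ) ≠ 0 := by positivity
  have H := hn.div ((hp.const_add 1).const_mul 2) hden
  have heq : (fun y => PsiSphere y t) =ᶠ[nhds x] fun y =>
      y * (√(y ^ 2 - 4 * (t - 1) * t) - (2 * t - 1) * y) / (2 * (1 + y ^ 2)) := by
    filter_upwards [lt_mem_nhds hx] with y hy using PsiSphere_eq hy.le t
  refine (H.congr_of_eventuallyEq heq).congr_deriv ?_
  simp only [Pi.sub_apply, Pi.mul_apply]
  set S := √(x ^ 2 - 4 * (t - 1) * t)
  have : 1 + x ^ 2 ≠ 0 := by positivity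
  field_simp
  linear_combination (1 - x ^ 2) * hsq

/-- `Ψ(x,t) = (−(2t−1)x² + √(x⁴ − 4x²(t−1)t))/(2(1+x²))` satisfies
`(1+x²)Ψ² + (2t−1)x²Ψ + x²t(t−1) = 0` and solves `∂Ψ/∂t = x·(∂Ψ/∂x)/Ψ − 1` for all `x > 0`
and `0 < t < 1`; its `x`-derivative equals
`−x(2t−1)/(1+x²)² + (x² − 2t² + 2t²x² + 2t − 2tx²)/((1+x²)²√(x² − 4(t−1)t))`. -/
theorem stmt_11 :
    ∀ t ∈ Set.Ioo (0:ℝ) 1, ∀ x > (0:ℝ),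
      (1 + x ^ 2) * (PsiSphere x t) ^ 2 + (2 * t - 1) * x ^ 2 * PsiSphere x t
          + x ^ 2 * t * (t - 1) = 0 ∧
      deriv (fun s => PsiSphere x s) t
          = x * deriv (fun y => PsiSphere y t) x / PsiSphere x t - 1 ∧
      deriv (fun y => PsiSphere y t) x
          = -x * (2 * t - 1) / (1 + x ^ 2) ^ 2 +
            (x ^ 2 - 2 * t ^ 2 + 2 * t ^ 2 * x ^ 2 + 2 * t - 2 * t * x ^ 2) /
              ((1 + x ^ 2) ^ 2 * Real.sqrt (x ^ 2 - 4 * (t - 1) * t)) := by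
  rintro t ⟨ht0, ht1⟩ x hx
  have hpos : 0 < t * (1 - t) := mul_pos ht0 (sub_pos.2 ht1)
  have h : 0 < x ^ 2 - 4 * (t - 1) * t := by nlinarith
  have hS := Real.sqrt_pos.2 h
  have hsq := Real.sq_sqrt h.le
  have hx1 : 1 + x ^ 2 ≠ 0 := by positivity
  have hfac : 0 < √(x ^ 2 - 4 * (t - 1) * t) - (2 * t - 1) * x := by
    rw [sub_pos]
    apply Real.lt_sqrt_of_sq_lt
    nlinarith [mul_pos hpos (by positivity : 0 < 1 + x ^ 2)]
  refine ⟨?_, ?_, (hasDerivAt_PsiSphere_left hx h).deriv⟩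
  · rw [PsiSphere_eq hx.le]
    set S := √(x ^ 2 - 4 * (t - 1) * t)
    field_simp
    linear_combination x ^ 2 * hsq
  · rw [(hasDerivAt_PsiSphere_right hx.le h).deriv, (hasDerivAt_PsiSphere_left hx h).deriv,
      PsiSphere_eq hx.le]
    set S := √(x ^ 2 - 4 * (t - 1) * t)
    have hfac' := hfac.ne'
    rw [eq_sub_iff_add_eq, eq_div_iff (by positivity)]
    field_simp
    linear_combination hsq
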